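/- arXiv:2311.01706 — 2 statements merged into one kernel-verified Lean document; each statement's English description precedes it below -/
import Mathlib

section
/- Let R be a commutative Noetherian ring, M a finitely generated R-module, and N a proper submodule of M. Any two regular prime extension filtrations of M over N, say with prime ideals p_1, …, p_n and q_1, …, q_m respectively, have the same length n = m and determine the same multiset of prime ideals: each prime ideal of R occurs the same number of times among p_1, …, p_n as among q_1, …, q_m. -/
open Submodule

section Defs

variable {R : Type*} [CommRing R] {M : Type*} [AddCommGroup M] [Module R M]

/-- `K` is a `p`-prime extension of `N` (i.e. `N` is a `p`-prime submodule of `K`):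
`(N : K) = p` and for all `a : R`, `x ∈ K`, `a • x ∈ N` implies `a ∈ p` or `x ∈ N`. -/
def IsPrimeExtension (p : Ideal R) (N K : Submodule R M) : Prop :=
  p.IsPrime ∧ N ≤ K ∧ N.colon K = p ∧
    ∀ (a : R) (x : M), x ∈ K → a • x ∈ N → a ∈ p ∨ x ∈ N

/-- `K` is a maximal `p`-prime extension of `N` in the ambient module: no `p`-prime
extension of `N` properly contains `K`. -/
def IsMaximalPrimeExtension (p : Ideal R) (N K : Submodule R M) : Prop :=
  IsPrimeExtension p N K ∧ ∀ L : Submodule R M, IsPrimeExtension p N L → ¬ K < L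

/-- `K` is a regular `p`-prime extension of `N` in the ambient module: `K` is a maximal
`p`-prime extension of `N` and `p` is a maximal element of `Ass(M/N)`. -/
def IsRegularPrimeExtension (p : Ideal R) (N K : Submodule R M) : Prop :=
  IsMaximalPrimeExtension p N K ∧ p ∈ associatedPrimes R (M ⧸ N) ∧
    ∀ q ∈ associatedPrimes R (M ⧸ N), p ≤ q → q = p

/-- `F 0 = N ⊂ F 1 ⊂ ⋯ ⊂ F n = M` is a regular prime extension (RPE) filtration
of the ambient module over `N`, with prime ideals `p 0, …, p (n-1)`. -/
def IsRPEFiltration (N : Submodule R M) (n : ℕ) (F : Fin (n + 1) → Submodule R M)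
    (p : Fin n → Ideal R) : Prop :=
  F 0 = N ∧ F (Fin.last n) = ⊤ ∧
    ∀ i : Fin n, IsRegularPrimeExtension (p i) (F i.castSucc) (F i.succ)

/-- `N` has generalized prime ideal factorization given by the multiset `S` of primes. -/
def HasPFactorization (N : Submodule R M) (S : Multiset (Ideal R)) : Prop :=
  ∃ (n : ℕ) (F : Fin (n + 1) → Submodule R M) (p : Fin n → Ideal R),
    IsRPEFiltration N n F p ∧ (List.ofFn p : Multiset (Ideal R)) = S

end Defs

section Auxiliary

variable {R : Type*} [CommRing R] {M : Type*} [AddCommGroup M] [Module R M]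

/-- The elements of `M` that some multiplier outside `P` carries into `(N : P ^ k)`. For prime `P`
this is the contraction to `M` of the submodule `(N_P : P_P ^ k)` of the localization `M_P`. -/
def localizedColonPow (P : Ideal R) (k : ℕ) (N : Submodule R M) : Set M :=
  {x | ∃ s ∉ P, ∀ b ∈ P ^ k, (s * b) • x ∈ N}

/-- The indices at which the chain `localizedColonPow P · N` is stationary. -/
def stationaryIndices (P : Ideal R) (N : Submodule R M) : Set ℕ :=
  {j | localizedColonPow P j N = localizedColonPow P (j + 1) N}

variable {N K : Submodule R M} {P q : Ideal R}

theorem mem_localizedColonPow_zero {x : M} :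
    x ∈ localizedColonPow P 0 N ↔ ∃ s ∉ P, s • x ∈ N := by
  refine ⟨fun ⟨s, hs, h⟩ ↦ ⟨s, hs, by simpa using h 1 (by simp)⟩, fun ⟨s, hs, h⟩ ↦ ⟨s, hs, ?_⟩⟩
  intro b _
  rw [mul_comm, mul_smul]
  exact N.smul_mem b h

theorem mem_localizedColonPow_one {x : M} :
    x ∈ localizedColonPow P 1 N ↔ ∃ s ∉ P, ∀ b ∈ P, (s * b) • x ∈ N := by
  simp [localizedColonPow]

theorem zero_mem_stationaryIndices_iff :
    0 ∈ stationaryIndices P N ↔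
      ∀ x : M, (∃ s ∉ P, ∀ b ∈ P, (s * b) • x ∈ N) → ∃ s ∉ P, s • x ∈ N := by
  change localizedColonPow P 0 N = localizedColonPow P 1 N ↔ _
  rw [Set.ext_iff]
  refine forall_congr' fun x ↦ ?_
  rw [mem_localizedColonPow_zero, mem_localizedColonPow_one]
  refine ⟨fun h ↦ h.2, fun h ↦ ⟨fun ⟨s, hs, hx⟩ ↦ ⟨s, hs, fun b _ ↦ ?_⟩, h⟩⟩
  rw [mul_comm, mul_smul]
  exact N.smul_mem b hx

theorem mem_associatedPrimes_quotient_iff [IsNoetherianRing R] :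
    P ∈ associatedPrimes R (M ⧸ N) ↔ P.IsPrime ∧ ∃ x : M, P = N.colon {x} := by
  rw [AssociatedPrimes.mem_iff, isAssociatedPrime_iff, (Submodule.mkQ_surjective N).exists]
  have h (x : M) : (⊥ : Submodule R (M ⧸ N)).colon {N.mkQ x} = N.colon {x} := by
    ext a
    rw [mem_colon_singleton, mem_colon_singleton, mem_bot, ← map_smul, mkQ_apply,
      Quotient.mk_eq_zero]
  simp_rw [h]

theorem zero_mem_stationaryIndices_iff_notMem_associatedPrimes [IsNoetherianRing R]
    (hP : P.IsPrime) :
    0 ∈ stationaryIndices P N ↔ P ∉ associatedPrimes R (M ⧸ N) := by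
  rw [zero_mem_stationaryIndices_iff, mem_associatedPrimes_quotient_iff]
  constructor
  · rintro h ⟨-, x, hx⟩
    obtain ⟨s, hs, hsx⟩ := h x ⟨1, hP.one_notMem, fun b hb ↦ by
      rw [hx] at hb
      simpa using hb⟩
    rw [hx] at hs
    exact hs (mem_colon_singleton.2 hsx)
  · rintro h x ⟨s, hs, hx⟩
    by_contra! hN
    refine h ⟨hP, s • x, ?_⟩
    ext a
    rw [mem_colon_singleton, ← mul_smul]
    refine ⟨fun ha ↦ mul_comm s a ▸ hx a ha, fun ha ↦ ?_⟩
    by_contra haP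
    exact hN (a * s) (hP.mul_notMem haP hs) ha

/-- A regular `q`-prime extension of `N` in `M` is the colon submodule `(N : q)`. -/
theorem IsRegularPrimeExtension.mem_iff [IsNoetherianRing R]
    (h : IsRegularPrimeExtension q N K) {x : M} : x ∈ K ↔ ∀ a ∈ q, a • x ∈ N := by
  obtain ⟨⟨⟨hq, hNK, hcol, -⟩, hmax⟩, hass, hqmax⟩ := h
  have hKN {x : M} (hx : x ∈ K) : ∀ a ∈ q, a • x ∈ N := fun a ha ↦ by
    rw [← hcol] at ha
    exact mem_colon.1 ha x hx
  let L : Submodule R M :=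
    { carrier := {x | ∀ a ∈ q, a • x ∈ N}
      add_mem' := fun hx hy a ha ↦ by
        rw [smul_add]
        exact N.add_mem (hx a ha) (hy a ha)
      zero_mem' := fun a _ ↦ by simp
      smul_mem' := fun c x hx a ha ↦ by
        rw [smul_comm]
        exact N.smul_mem c (hx a ha) }
  have hKL : K ≤ L := fun _ ↦ hKN
  have htors (a : R) (x : M) (hx : x ∈ L) (hax : a • x ∈ N) : a ∈ q ∨ x ∈ N := by
    by_contra! hcon
    obtain ⟨ha, hxN⟩ := hcon
    obtain ⟨P, hP, hle⟩ := exists_le_isAssociatedPrime_of_isNoetherianRing R (N.mkQ x)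
      (by simpa using hxN)
    have hmem {b : R} (hb : b • x ∈ N) : b ∈ P := by
      refine hle (mem_colon_singleton.2 ?_)
      rw [mem_bot, ← map_smul, mkQ_apply, Quotient.mk_eq_zero]
      exact hb
    exact ha (hqmax P hP (fun b hb ↦ hmem (hx b hb)) ▸ hmem hax)
  have hcolL : N.colon (L : Set M) = q := by
    refine le_antisymm ?_ fun a ha ↦ mem_colon.2 fun x (hx : x ∈ L) ↦ hx a ha
    exact (colon_mono le_rfl hKL).trans hcol.le
  have hLK : ¬ K < L := hmax L ⟨hq, hNK.trans hKL, hcolL, htors⟩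
  rw [eq_of_le_of_not_lt hKL hLK]
  rfl

theorem localizedColonPow_colon (hK : ∀ x, x ∈ K ↔ ∀ a ∈ P, a • x ∈ N) (j : ℕ) :
    localizedColonPow P j K = localizedColonPow P (j + 1) N := by
  ext x
  refine exists_congr fun s ↦ and_congr_right fun _ ↦ ?_
  have h (c : R) : (s * c) • x ∈ N ↔ c ∈ N.colon {s • x} := by
    rw [mem_colon_singleton, ← mul_smul, mul_comm]
  simp_rw [hK, ← mul_smul, h]
  change _ ↔ P ^ (j + 1) ≤ _
  rw [pow_succ, Ideal.mul_le]
  refine forall₂_congr fun b _ ↦ forall₂_congr fun a _ ↦ ?_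
  rw [← h, mul_left_comm, mul_comm a b]

theorem localizedColonPow_eq_of_not_le (hP : P.IsPrime) (hK : ∀ x, x ∈ K ↔ ∀ a ∈ q, a • x ∈ N)
    (hqP : ¬ q ≤ P) (j : ℕ) :
    localizedColonPow P j K = localizedColonPow P j N := by
  obtain ⟨t, htq, htP⟩ := SetLike.not_le_iff_exists.1 hqP
  ext x
  constructor
  · rintro ⟨s, hs, hx⟩
    refine ⟨t * s, hP.mul_notMem htP hs, fun b hb ↦ ?_⟩
    rw [mul_assoc, mul_smul]
    exact (hK _).1 (hx b hb) t htq
  · rintro ⟨s, hs, hx⟩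
    exact ⟨s, hs, fun b hb ↦ (hK _).2 fun a _ ↦ N.smul_mem a (hx b hb)⟩

theorem exists_notMem_forall_smul_mem [IsNoetherianRing R] (hP : P.IsPrime) {x : M}
    (h : ∀ a ∈ q, ∃ t ∉ P, t • a • x ∈ N) : ∃ t ∉ P, ∀ a ∈ q, t • a • x ∈ N := by
  classical
  obtain ⟨S, rfl⟩ := (isNoetherianRing_iff_ideal_fg R).1 inferInstance q
  choose! t ht htx using fun a (ha : a ∈ S) ↦ h a (Ideal.subset_span ha)
  refine ⟨∏ a ∈ S, t a, ?_, ?_⟩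
  · rw [hP.prod_mem_iff]
    rintro ⟨a, ha, hat⟩
    exact ht a ha hat
  · suffices Ideal.span (S : Set R) ≤ N.colon {(∏ a ∈ S, t a) • x} by
      intro a ha
      rw [smul_comm]
      exact mem_colon_singleton.1 (this ha)
    refine Ideal.span_le.2 fun a ha ↦ ?_
    rw [SetLike.mem_coe, mem_colon_singleton, smul_comm, ← Finset.prod_erase_mul _ _ ha, mul_smul]
    exact N.smul_mem _ (htx a ha)

theorem zero_mem_stationaryIndices_colon [IsNoetherianRing R] (hP : P.IsPrime)
    (hK : ∀ x, x ∈ K ↔ ∀ a ∈ q, a • x ∈ N) (h : 0 ∈ stationaryIndices P N) :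
    0 ∈ stationaryIndices P K := by
  rw [zero_mem_stationaryIndices_iff] at h ⊢
  rintro x ⟨s, hs, hx⟩
  obtain ⟨t, ht, htx⟩ := exists_notMem_forall_smul_mem (N := N) (q := q) (x := x) hP fun a ha ↦
    h (a • x) ⟨s, hs, fun b hb ↦ by
      rw [smul_comm]
      exact (hK _).1 (hx b hb) a ha⟩
  refine ⟨t, ht, (hK _).2 fun a ha ↦ ?_⟩
  rw [smul_comm]
  exact htx a ha

theorem IsRegularPrimeExtension.isLeast_stationaryIndices_succ [IsNoetherianRing R]
    (h : IsRegularPrimeExtension P N K) {k : ℕ} (hk : IsLeast (stationaryIndices P K) k) :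
    IsLeast (stationaryIndices P N) (k + 1) := by
  have hiff (j : ℕ) : j + 1 ∈ stationaryIndices P N ↔ j ∈ stationaryIndices P K := by
    change _ = _ ↔ _ = _
    simp only [localizedColonPow_colon fun _ ↦ h.mem_iff]
  refine ⟨(hiff k).2 hk.1, fun j hj ↦ ?_⟩
  cases j with
  | zero =>
    exact absurd h.2.1 ((zero_mem_stationaryIndices_iff_notMem_associatedPrimes h.1.1.1).1 hj)
  | succ j => exact Nat.succ_le_succ (hk.2 ((hiff j).1 hj))

theorem IsRegularPrimeExtension.isLeast_stationaryIndices_of_ne [IsNoetherianRing R]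
    (h : IsRegularPrimeExtension q N K) (hP : P.IsPrime) (hqP : q ≠ P) {k : ℕ}
    (hk : IsLeast (stationaryIndices P K) k) : IsLeast (stationaryIndices P N) k := by
  have hK : ∀ x, x ∈ K ↔ ∀ a ∈ q, a • x ∈ N := fun _ ↦ h.mem_iff
  by_cases hle : q ≤ P
  · have h0 : 0 ∈ stationaryIndices P N :=
      (zero_mem_stationaryIndices_iff_notMem_associatedPrimes hP).2 fun hass ↦
        hqP (h.2.2 P hass hle).symm
    obtain rfl : k = 0 := Nat.le_zero.1 (hk.2 (zero_mem_stationaryIndices_colon hP hK h0))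
    exact ⟨h0, fun _ _ ↦ Nat.zero_le _⟩
  · have : stationaryIndices P N = stationaryIndices P K := by
      simp only [stationaryIndices, localizedColonPow_eq_of_not_le hP hK hle]
    rwa [this]

open Classical in
/-- The multiplicity of a prime `P` in an RPE filtration over `N` depends only on `N` and `P`. -/
theorem IsRPEFiltration.isLeast_count [IsNoetherianRing R] (hP : P.IsPrime) {n : ℕ}
    {F : Fin (n + 1) → Submodule R M} {p : Fin n → Ideal R} (h : IsRPEFiltration N n F p) :
    IsLeast (stationaryIndices P N) ((List.ofFn p).count P) := by
  induction n generalizing N with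
  | zero =>
    obtain rfl : N = ⊤ := h.1.symm.trans h.2.1
    refine ⟨?_, fun _ _ ↦ by simp⟩
    rw [List.ofFn_zero, List.count_nil, zero_mem_stationaryIndices_iff]
    exact fun x ⟨s, hs, _⟩ ↦ ⟨s, hs, mem_top⟩
  | succ n ih =>
    have htail : IsRPEFiltration (F 1) n (fun i ↦ F i.succ) (fun i ↦ p i.succ) :=
      ⟨rfl, h.2.1, fun i ↦ h.2.2 i.succ⟩
    have hstep : IsRegularPrimeExtension (p 0) N (F 1) := by
      rw [← h.1]
      exact h.2.2 0
    rw [List.ofFn_succ, List.count_cons]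
    by_cases hp : p 0 = P
    · subst hp
      simpa using hstep.isLeast_stationaryIndices_succ (ih htail)
    · simpa [hp] using hstep.isLeast_stationaryIndices_of_ne hP hp (ih htail)

end Auxiliary

/-- Any two RPE filtrations of `M` over a proper submodule `N` have the same length
and determine the same multiset of prime ideals. -/
theorem stmt_7 {R : Type*} [CommRing R] [IsNoetherianRing R]
    {M : Type*} [AddCommGroup M] [Module R M] [Module.Finite R M]
    (N : Submodule R M) (hN : N ≠ ⊤) (n m : ℕ)
    (F : Fin (n + 1) → Submodule R M) (p : Fin n → Ideal R)
    (G : Fin (m + 1) → Submodule R M) (q : Fin m → Ideal R)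
    (hF : IsRPEFiltration N n F p) (hG : IsRPEFiltration N m G q) :
    n = m ∧ (List.ofFn p : Multiset (Ideal R)) = (List.ofFn q : Multiset (Ideal R)) := by
  classical
  have hmultiset :
      (List.ofFn p : Multiset (Ideal R)) = (List.ofFn q : Multiset (Ideal R)) := by
    ext P
    rw [Multiset.coe_count, Multiset.coe_count]
    by_cases hP : P.IsPrime
    · exact (hF.isLeast_count hP).unique (hG.isLeast_count hP)
    · rw [List.count_eq_zero_of_not_mem, List.count_eq_zero_of_not_mem]
      · rintro hmem
        obtain ⟨i, rfl⟩ := (List.mem_ofFn' _ _).1 hmem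
        exact hP (hG.2.2 i).1.1.1
      · rintro hmem
        obtain ⟨i, rfl⟩ := (List.mem_ofFn' _ _).1 hmem
        exact hP (hF.2.2 i).1.1.1
  refine ⟨?_, hmultiset⟩
  simpa using congrArg Multiset.card hmultiset
end

section
/- Let R be a commutative Noetherian ring, M a finitely generated R-module, N a proper submodule of M, and a = Ann_R(M/N) = (N : M). Then the generalized prime ideal factorization P_M(N) is a multiple of the generalized prime ideal factorization P_R(a) as a product of prime ideals; that is, the multiset of prime ideals (counted with multiplicity) occurring in P_R(a) is contained in the multiset of prime ideals occurring in P_M(N). -/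
open Submodule

section Transporter

variable {R : Type*} [CommRing R] {M : Type*} [AddCommGroup M] [Module R M]

/-- The submodule `(N :_M I)` of all `x` with `I • x ⊆ N`. -/
def Submodule.transporter (N : Submodule R M) (I : Ideal R) : Submodule R M where
  carrier := {x | ∀ r ∈ I, r • x ∈ N}
  zero_mem' r _ := by simp
  add_mem' hx hy r hr := by
    rw [smul_add]
    exact N.add_mem (hx r hr) (hy r hr)
  smul_mem' c x hx r hr := by
    rw [smul_comm]
    exact N.smul_mem c (hx r hr)

theorem Submodule.mem_transporter {N : Submodule R M} {I : Ideal R} {x : M} :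
    x ∈ N.transporter I ↔ ∀ r ∈ I, r • x ∈ N := Iff.rfl

theorem Submodule.le_transporter (N : Submodule R M) (I : Ideal R) : N ≤ N.transporter I :=
  fun _ hx r _ ↦ N.smul_mem r hx

theorem Submodule.transporter_mono {N K : Submodule R M} (h : N ≤ K) (I : Ideal R) :
    N.transporter I ≤ K.transporter I :=
  fun _ hx r hr ↦ h (hx r hr)

theorem Submodule.transporter_one (N : Submodule R M) : N.transporter 1 = N := by
  refine le_antisymm (fun x hx ↦ ?_) (N.le_transporter 1)
  simpa using hx 1 (by simp)

theorem Submodule.transporter_transporter (N : Submodule R M) (I J : Ideal R) :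
    (N.transporter I).transporter J = N.transporter (I * J) := by
  ext x
  constructor
  · intro hx r hr
    induction hr using Submodule.mul_induction_on' with
    | mem_mul_mem a ha b hb =>
      rw [mul_smul]
      exact hx b hb a ha
    | add a _ b _ ha hb =>
      rw [add_smul]
      exact N.add_mem ha hb
  · intro hx b hb a ha
    rw [← mul_smul]
    exact hx _ (Ideal.mul_mem_mul ha hb)

theorem Submodule.transporter_comm (N : Submodule R M) (I J : Ideal R) :
    (N.transporter I).transporter J = (N.transporter J).transporter I := by
  rw [transporter_transporter, transporter_transporter, mul_comm]

theorem Submodule.FG.exists_notMem_forall_smul_mem {L : Submodule R M} (hL : L.FG)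
    {p : Ideal R} [p.IsPrime] {N : Submodule R M} (h : ∀ y ∈ L, ∃ t ∉ p, t • y ∈ N) :
    ∃ t ∉ p, ∀ y ∈ L, t • y ∈ N := by
  induction L, hL using Submodule.fg_induction with
  | singleton x =>
    obtain ⟨t, ht, hx⟩ := h x (mem_span_singleton_self x)
    refine ⟨t, ht, fun y hy ↦ ?_⟩
    obtain ⟨c, rfl⟩ := mem_span_singleton.mp hy
    rw [smul_comm]
    exact N.smul_mem c hx
  | sup L₁ L₂ _ _ ih₁ ih₂ =>
    obtain ⟨t₁, ht₁, h₁⟩ := ih₁ fun y hy ↦ h y (mem_sup_left hy)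
    obtain ⟨t₂, ht₂, h₂⟩ := ih₂ fun y hy ↦ h y (mem_sup_right hy)
    refine ⟨t₁ * t₂, Ideal.IsPrime.mul_notMem ‹_› ht₁ ht₂, fun y hy ↦ ?_⟩
    obtain ⟨y₁, hy₁, y₂, hy₂, rfl⟩ := mem_sup.mp hy
    rw [smul_add]
    refine N.add_mem ?_ ?_
    · rw [mul_comm, mul_smul]
      exact N.smul_mem _ (h₁ y₁ hy₁)
    · rw [mul_smul]
      exact N.smul_mem _ (h₂ y₂ hy₂)

theorem Submodule.exists_notMem_smul_mem_transporter [IsNoetherianRing R] {p : Ideal R}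
    [p.IsPrime] {N : Submodule R M} {I : Ideal R} {x : M}
    (h : ∀ r ∈ I, ∃ t ∉ p, t • r • x ∈ N) : ∃ t ∉ p, t • x ∈ N.transporter I := by
  obtain ⟨t, ht, hI⟩ := (IsNoetherian.noetherian I).exists_notMem_forall_smul_mem (p := p)
    (N := N.comap (LinearMap.toSpanSingleton R M x)) (by simpa [mul_smul] using h)
  refine ⟨t, ht, fun r hr ↦ ?_⟩
  simpa [mul_smul, smul_comm t r x] using hI r hr

end Transporter

section TorsionBound

variable {R : Type*} [CommRing R] {M : Type*} [AddCommGroup M] [Module R M]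

/-- `p ^ k` annihilates the `p`-power torsion of the localization of `M ⧸ N` at `p`. -/
def IsTorsionBound (p : Ideal R) (N : Submodule R M) (k : ℕ) : Prop :=
  ∀ (x : M) (j : ℕ), x ∈ N.transporter (p ^ j) → ∃ t ∉ p, t • x ∈ N.transporter (p ^ k)

theorem Submodule.smul_mkQ_eq_zero {N : Submodule R M} {r : R} {x : M} :
    r • N.mkQ x = 0 ↔ r • x ∈ N := by
  rw [← map_smul, mkQ_apply, Submodule.Quotient.mk_eq_zero]

theorem mem_associatedPrimes_quotient_iff_s15 [IsNoetherianRing R] {p : Ideal R}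
    {N : Submodule R M} :
    p ∈ associatedPrimes R (M ⧸ N) ↔ p.IsPrime ∧ ∃ x : M, ∀ r, r ∈ p ↔ r • x ∈ N := by
  rw [AssociatedPrimes.mem_iff, isAssociatedPrime_iff, N.mkQ_surjective.exists]
  simp only [SetLike.ext_iff, mem_colon_singleton, mem_bot, smul_mkQ_eq_zero]

theorem IsTorsionBound.mono {p : Ideal R} {N : Submodule R M} {k l : ℕ}
    (h : IsTorsionBound p N k) (hkl : k ≤ l) : IsTorsionBound p N l := by
  intro x j hx
  obtain ⟨t, ht, htx⟩ := h x j hx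
  exact ⟨t, ht, fun r hr ↦ htx r (Ideal.pow_le_pow_right hkl hr)⟩

theorem isTorsionBound_zero [IsNoetherianRing R] {p : Ideal R} [hp : p.IsPrime]
    {N : Submodule R M} (h : p ∉ associatedPrimes R (M ⧸ N)) : IsTorsionBound p N 0 := by
  intro x j hx
  rw [pow_zero, transporter_one]
  induction j generalizing x with
  | zero =>
    rw [pow_zero, transporter_one] at hx
    exact ⟨1, hp.one_notMem, by simpa using hx⟩
  | succ j ih =>
    rw [pow_succ, ← transporter_transporter] at hx
    obtain ⟨t, ht, htx⟩ := exists_notMem_smul_mem_transporter fun r hr ↦ ih _ (hx r hr)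
    by_contra! hcon
    refine h (mem_associatedPrimes_quotient_iff_s15.mpr ⟨hp, t • x, fun r ↦ ⟨htx r, fun hr ↦ ?_⟩⟩)
    by_contra hrp
    exact hcon (r * t) (hp.mul_notMem hrp ht) (by rwa [mul_smul])

theorem not_isTorsionBound_zero [IsNoetherianRing R] {p : Ideal R} {N : Submodule R M}
    (h : p ∈ associatedPrimes R (M ⧸ N)) : ¬ IsTorsionBound p N 0 := by
  obtain ⟨hp, x, hx⟩ := mem_associatedPrimes_quotient_iff_s15.mp h
  intro hN
  obtain ⟨t, ht, htx⟩ := hN x 1 (by simpa [mem_transporter] using fun r ↦ (hx r).mp)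
  rw [pow_zero, transporter_one] at htx
  exact ht ((hx t).mpr htx)

theorem IsTorsionBound.transporter [IsNoetherianRing R] {p : Ideal R} [p.IsPrime]
    {N : Submodule R M} {k : ℕ} (h : IsTorsionBound p N k) (q : Ideal R) :
    IsTorsionBound p (N.transporter q) k := by
  intro x j hx
  rw [transporter_comm] at hx ⊢
  exact exists_notMem_smul_mem_transporter fun r hr ↦ h _ j (hx r hr)

theorem IsTorsionBound.of_transporter_self {p : Ideal R} {N : Submodule R M} {k : ℕ}
    (h : IsTorsionBound p (N.transporter p) k) : IsTorsionBound p N (k + 1) := by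
  intro x j hx
  rw [pow_succ', ← transporter_transporter]
  exact h x j (transporter_mono (N.le_transporter p) _ hx)

theorem IsTorsionBound.of_transporter {p q : Ideal R} [hp : p.IsPrime] {N : Submodule R M}
    {k : ℕ} (h : IsTorsionBound p (N.transporter q) k) (hqp : ¬ q ≤ p) :
    IsTorsionBound p N k := by
  intro x j hx
  obtain ⟨t, ht, htx⟩ := h x j (transporter_mono (N.le_transporter q) _ hx)
  obtain ⟨u, huq, hup⟩ := SetLike.not_le_iff_exists.mp hqp
  rw [transporter_comm] at htx
  exact ⟨u * t, hp.mul_notMem hup ht, by simpa [mul_smul] using htx u huq⟩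

theorem IsTorsionBound.transporter_self {p : Ideal R} {N : Submodule R M} {k : ℕ}
    (h : IsTorsionBound p N (k + 1)) : IsTorsionBound p (N.transporter p) k := by
  intro x j hx
  rw [transporter_transporter, ← pow_succ'] at hx ⊢
  exact h x (j + 1) hx

theorem IsTorsionBound.colon_top [Module.Finite R M] {p : Ideal R} [p.IsPrime]
    {N : Submodule R M} {k : ℕ} (h : IsTorsionBound p N k) :
    IsTorsionBound (M := R) p (N.colon ⊤) k := by
  intro a j ha
  obtain ⟨t, ht, hta⟩ :=
    (Module.Finite.fg_top (R := R) (M := M)).exists_notMem_forall_smul_mem (p := p)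
      (N := (N.transporter (p ^ k)).comap (LinearMap.lsmul R M a)) fun m _ ↦ by
        obtain ⟨t, ht, htm⟩ := h (a • m) j fun r hr ↦ by
          rw [← mul_smul]
          exact mem_colon.mp (ha r hr) m trivial
        exact ⟨t, ht, by simpa [smul_comm a t m] using htm⟩
  refine ⟨t, ht, fun r hr ↦ mem_colon.mpr fun m _ ↦ ?_⟩
  simpa [mul_smul, smul_comm a t m] using hta m trivial r hr

end TorsionBound

section Factorization

variable {R : Type*} [CommRing R] {M : Type*} [AddCommGroup M] [Module R M]

theorem IsRegularPrimeExtension.eq_transporter [IsNoetherianRing R] {p : Ideal R}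
    {N K : Submodule R M} (h : IsRegularPrimeExtension p N K) : K = N.transporter p := by
  obtain ⟨⟨⟨hp, hNK, hcolon, -⟩, hmax⟩, -, hass⟩ := h
  have hK : K ≤ N.transporter p := fun x hx r hr ↦ by
    rw [← hcolon] at hr
    exact mem_colon.mp hr x hx
  refine eq_of_le_of_not_lt hK (hmax _ ⟨hp, N.le_transporter p, ?_, ?_⟩)
  · refine le_antisymm ?_ fun r hr ↦ mem_colon.mpr fun x hx ↦ mem_transporter.mp hx r hr
    rw [← hcolon]
    exact colon_mono le_rfl (hcolon ▸ hK)
  · intro a x hx hax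
    by_contra! hcon
    obtain ⟨q, hq, hle⟩ := exists_le_isAssociatedPrime_of_isNoetherianRing R (N.mkQ x)
      (by simpa using hcon.2)
    have hmem (r : R) (hr : r • x ∈ N) : r ∈ q := hle <|
      mem_colon_singleton.mpr <| (mem_bot R).mpr <| smul_mkQ_eq_zero.mpr hr
    rw [hass q hq fun r hr ↦ hmem r (hx r hr)] at hmem
    exact hcon.1 (hmem a hax)

@[elab_as_elim]
theorem HasPFactorization.induction {motive : Submodule R M → Multiset (Ideal R) → Prop}
    (top : motive ⊤ 0)
    (cons : ∀ (N K : Submodule R M) (q : Ideal R) (S : Multiset (Ideal R)),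
      IsRegularPrimeExtension q N K → motive K S → motive N (q ::ₘ S))
    {N : Submodule R M} {S : Multiset (Ideal R)} (h : HasPFactorization N S) : motive N S := by
  obtain ⟨n, F, p, ⟨h0, hlast, hstep⟩, rfl⟩ := h
  induction n generalizing N with
  | zero =>
    have : N = ⊤ := by rw [← h0, ← hlast]; rfl
    simpa [this] using top
  | succ n ih =>
    rw [List.ofFn_succ, ← Multiset.cons_coe]
    refine cons N (F 1) _ _ (h0 ▸ hstep 0) ?_
    exact ih (fun i ↦ F i.succ) (fun i ↦ p i.succ) rfl hlast fun i ↦ hstep i.succ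

theorem HasPFactorization.isPrime {N : Submodule R M} {S : Multiset (Ideal R)}
    (h : HasPFactorization N S) : ∀ p ∈ S, p.IsPrime := by
  refine HasPFactorization.induction ?_ ?_ h
  · simp
  · intro N K q S hq ih p hp
    obtain rfl | hp := Multiset.mem_cons.mp hp
    exacts [hq.1.1.1, ih p hp]

open scoped Classical in
theorem HasPFactorization.isTorsionBound_count [IsNoetherianRing R] {N : Submodule R M}
    {S : Multiset (Ideal R)} (h : HasPFactorization N S) (p : Ideal R) [p.IsPrime] :
    IsTorsionBound p N (S.count p) := by
  refine HasPFactorization.induction ?_ ?_ h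
  · exact fun x j _ ↦ ⟨1, Ideal.IsPrime.one_notMem ‹_›, fun r _ ↦ trivial⟩
  · intro N K q S hq ih
    have hK := hq.eq_transporter
    subst hK
    by_cases hpq : p = q
    · subst hpq
      rw [Multiset.count_cons_self]
      exact ih.of_transporter_self
    · rw [Multiset.count_cons_of_ne hpq]
      by_cases hle : q ≤ p
      · exact (isTorsionBound_zero fun hp ↦ hpq (hq.2.2 p hp hle)).mono (Nat.zero_le _)
      · exact ih.of_transporter hle

open scoped Classical in
theorem HasPFactorization.count_le [IsNoetherianRing R] {N : Submodule R M}
    {S : Multiset (Ideal R)} (h : HasPFactorization N S) {p : Ideal R} [p.IsPrime] {k : ℕ}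
    (hk : IsTorsionBound p N k) : S.count p ≤ k := by
  refine HasPFactorization.induction
    (motive := fun N S ↦ ∀ k, IsTorsionBound p N k → S.count p ≤ k) ?_ ?_ h k hk
  · simp
  · intro N K q S hq ih k hk
    have hK := hq.eq_transporter
    subst hK
    by_cases hpq : p = q
    · subst hpq
      rw [Multiset.count_cons_self]
      cases k with
      | zero => exact absurd hk (not_isTorsionBound_zero hq.2.1)
      | succ k => exact Nat.succ_le_succ (ih k hk.transporter_self)
    · rw [Multiset.count_cons_of_ne hpq]
      exact ih k (hk.transporter q)

end Factorization

/-- For a proper submodule `N` of `M` with `a = Ann_R(M/N) = (N : M)`, the factorization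
`P_M(N)` is a multiple of `P_R(a)`: the multiset of primes of `P_R(a)` is contained
(with multiplicity) in the multiset of primes of `P_M(N)`. -/
theorem stmt_15 {R : Type*} [CommRing R] [IsNoetherianRing R]
    {M : Type*} [AddCommGroup M] [Module R M] [Module.Finite R M]
    (N : Submodule R M) (hN : N ≠ ⊤) (a : Ideal R) (ha : a = N.colon ⊤)
    (S T : Multiset (Ideal R))
    (hfN : HasPFactorization N S) (hfa : HasPFactorization (M := R) a T) :
    T ≤ S := by
  classical
  refine Multiset.le_iff_count.mpr fun p ↦ ?_
  by_cases hp : p ∈ T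
  · have := hfa.isPrime p hp
    subst ha
    exact hfa.count_le (hfN.isTorsionBound_count p).colon_top
  · simp [Multiset.count_eq_zero_of_notMem hp]
end
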